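/- arXiv:0902.0524 — 3 statements merged into one kernel-verified Lean document; each statement's English description precedes it below -/
import Mathlib

section
/- Let (X, T) be a reduced-form mechanism for a single-minded capacitated seller, with offered surplus ρ and utility U as defined. The mechanism is Bayesian incentive compatible and interim individually rational if and only if the following three conditions hold: (1) for every (c,q) ∈ [c̲,c̄]×[q̲,q̄], ρ(c,q) = ρ(c̄,q) + ∫_c^{c̄} X(t,q) dt; (2) ρ(c,q) ≥ 0 for all (c,q), and for every fixed c ∈ [c̲,c̄] the map q ↦ ρ(c,q) is non-decreasing on [q̲,q̄]; (3) for every fixed q ∈ [q̲,q̄] the map c ↦ X(c,q) is non-increasing on [c̲,c̄]. -/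
open Set

/-- A function whose increments are bounded by `(t - s) * (x s - x t)` takes equal values at the
endpoints of the interval. -/
theorem eq_of_abs_sub_le_mul_sub {G x : ℝ → ℝ} {a b : ℝ} (hab : a ≤ b)
    (h : ∀ s ∈ Icc a b, ∀ t ∈ Icc a b, s ≤ t → |G s - G t| ≤ (t - s) * (x s - x t)) :
    G a = G b := by
  have bound : ∀ n : ℕ, |G a - G b| * (n + 1) ≤ (b - a) * (x a - x b) := by
    intro n
    have hn : (0 : ℝ) < n + 1 := by positivity
    obtain ⟨d, hd⟩ : ∃ d, d = (b - a) / (n + 1) := ⟨_, rfl⟩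
    have hd0 : 0 ≤ d := hd ▸ div_nonneg (sub_nonneg.2 hab) hn.le
    have hnd : (n + 1) * d = b - a := by rw [hd]; field_simp
    have mem : ∀ k : ℕ, k ≤ n + 1 → a + k * d ∈ Icc a b := by
      intro k hk
      have hk' : (k : ℝ) ≤ n + 1 := by exact_mod_cast hk
      constructor
      · have : 0 ≤ k * d := by positivity
        linarith
      · linarith [mul_le_mul_of_nonneg_right hk' hd0]
    have step : ∀ k : ℕ, k ≤ n + 1 → |G a - G (a + k * d)| ≤ d * (x a - x (a + k * d)) := by
      intro k
      induction k with
      | zero => simp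
      | succ k ih =>
        intro hk
        have e : a + (k + 1 : ℕ) * d - (a + k * d) = d := by push_cast; ring
        have hs := h _ (mem k (by omega)) _ (mem (k + 1) hk) (by linarith)
        rw [e] at hs
        linarith [abs_sub_le (G a) (G (a + k * d)) (G (a + (k + 1 : ℕ) * d)), ih (by omega)]
    have hlast := step (n + 1) le_rfl
    have hb : a + ((n + 1 : ℕ) : ℝ) * d = b := by push_cast; linarith
    rw [hb] at hlast
    calc |G a - G b| * (n + 1) ≤ d * (x a - x b) * (n + 1) := by gcongr
      _ = (b - a) * (x a - x b) := by rw [← hnd]; ring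
  by_contra hne
  have hpos : 0 < |G a - G b| := abs_pos.2 (sub_ne_zero.2 hne)
  obtain ⟨n, hn⟩ := exists_nat_gt ((b - a) * (x a - x b) / |G a - G b|)
  rw [div_lt_iff₀ hpos] at hn
  linarith [bound n]

theorem AntitoneOn.mul_le_intervalIntegral {x : ℝ → ℝ} {s t : ℝ} (hst : s ≤ t)
    (hx : AntitoneOn x (Icc s t)) : (t - s) * x t ≤ ∫ u in s..t, x u := by
  have hi : IntervalIntegrable x MeasureTheory.volume s t :=
    AntitoneOn.intervalIntegrable (by rwa [uIcc_of_le hst])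
  simpa using intervalIntegral.integral_mono_on hst intervalIntegrable_const hi
    fun u hu => hx hu (right_mem_Icc.2 hst) hu.2

theorem AntitoneOn.intervalIntegral_le_mul {x : ℝ → ℝ} {s t : ℝ} (hst : s ≤ t)
    (hx : AntitoneOn x (Icc s t)) : ∫ u in s..t, x u ≤ (t - s) * x s := by
  have hi : IntervalIntegrable x MeasureTheory.volume s t :=
    AntitoneOn.intervalIntegrable (by rwa [uIcc_of_le hst])
  simpa using intervalIntegral.integral_mono_on hst hi intervalIntegrable_const
    fun u hu => hx (left_mem_Icc.2 hst) hu hu.1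

/-- If `-x` is a selection of subgradients of `r` on a set, then `x` is antitone there. -/
theorem antitoneOn_of_subgradient {r x : ℝ → ℝ} {S : Set ℝ}
    (h : ∀ t ∈ S, ∀ s ∈ S, r s - (t - s) * x s ≤ r t) : AntitoneOn x S := by
  intro s hs t ht hst
  rcases hst.eq_or_lt with rfl | hlt
  · rfl
  · refine le_of_mul_le_mul_left ?_ (sub_pos.2 hlt)
    linarith [h t ht s hs, h s hs t ht]

/-- Envelope formula: on a compact interval, `r` is recovered by integrating a selection `-x` of
its subgradients. -/
theorem eq_add_integral_of_subgradient {r x : ℝ → ℝ} {a b : ℝ} (hab : a ≤ b)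
    (h : ∀ t ∈ Icc a b, ∀ s ∈ Icc a b, r s - (t - s) * x s ≤ r t) :
    r a = r b + ∫ u in a..b, x u := by
  have hx := antitoneOn_of_subgradient h
  have hi : ∀ s ∈ Icc a b, ∀ t ∈ Icc a b, IntervalIntegrable x MeasureTheory.volume s t :=
    fun s hs t ht => (hx.mono (uIcc_subset_Icc hs ht)).intervalIntegrable
  have key := eq_of_abs_sub_le_mul_sub (G := fun s => r s - ∫ u in s..b, x u) (x := x) hab (by
    intro s hs t ht hst
    have hb := right_mem_Icc.2 hab
    have hadd := intervalIntegral.integral_add_adjacent_intervals (hi s hs t ht) (hi t ht b hb)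
    have hxst := hx.mono (Icc_subset_Icc hs.1 ht.2)
    have hlow := hxst.mul_le_intervalIntegral hst
    have hupp := hxst.intervalIntegral_le_mul hst
    have h₁ := h t ht s hs
    have h₂ := h s hs t ht
    rw [abs_le]
    constructor <;> linarith)
  simp only [intervalIntegral.integral_same] at key
  linarith

/-- A function given by the envelope formula with antitone integrand `x` has `-x` as a selection of
its subgradients. -/
theorem subgradient_of_eq_add_integral {r x : ℝ → ℝ} {a b : ℝ} (hx : AntitoneOn x (Icc a b))
    (h : ∀ s ∈ Icc a b, r s = r b + ∫ u in s..b, x u) {s t : ℝ} (hs : s ∈ Icc a b)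
    (ht : t ∈ Icc a b) : r s - (t - s) * x s ≤ r t := by
  have hb : b ∈ Icc a b := right_mem_Icc.2 (hs.1.trans hs.2)
  have hi : ∀ s ∈ Icc a b, ∀ t ∈ Icc a b, IntervalIntegrable x MeasureTheory.volume s t :=
    fun s hs t ht => (hx.mono (uIcc_subset_Icc hs ht)).intervalIntegrable
  have hrs := h s hs
  have hrt := h t ht
  rcases le_total s t with hst | hts
  · have hadd := intervalIntegral.integral_add_adjacent_intervals (hi s hs t ht) (hi t ht b hb)
    have hupp := (hx.mono (Icc_subset_Icc hs.1 ht.2)).intervalIntegral_le_mul hst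
    linarith
  · have hadd := intervalIntegral.integral_add_adjacent_intervals (hi t ht s hs) (hi s hs b hb)
    have hlow := (hx.mono (Icc_subset_Icc ht.1 hs.2)).mul_le_intervalIntegral hts
    linarith

/-- Theorem 1 (characterization of BIC + interim IR mechanisms for a
single-minded capacitated seller): the mechanism `(X, T)` with offered
surplus `ρ(c,q) = T(c,q) − c·X(c,q)` and utility
`U((ĉ,q̂),(c,q)) = ρ(ĉ,q̂) − (c−ĉ)·X(ĉ,q̂)` is BIC and IR iff
(1) the envelope formula `ρ(c,q) = ρ(c̄,q) + ∫_c^{c̄} X(t,q) dt` holds,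
(2) `ρ ≥ 0` and `ρ` is non-decreasing in `q`, and
(3) `X` is non-increasing in `c`. -/
theorem bic_ir_characterization
    (cl cu ql qu : ℝ) (hc : cl < cu) (hq : ql ≤ qu)
    (X T : ℝ → ℝ → ℝ)
    (ρ : ℝ → ℝ → ℝ)
    (hρ : ∀ c q, ρ c q = T c q - c * X c q)
    (U : ℝ × ℝ → ℝ × ℝ → ℝ)
    (hU : ∀ chat qhat c q, U (chat, qhat) (c, q) = ρ chat qhat - (c - chat) * X chat qhat) :
    -- BIC and interim IR ...
    ((∀ c ∈ Set.Icc cl cu, ∀ q ∈ Set.Icc ql qu,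
        ∀ chat ∈ Set.Icc cl cu, ∀ qhat ∈ Set.Icc ql q,
          U (chat, qhat) (c, q) ≤ U (c, q) (c, q)) ∧
     (∀ c ∈ Set.Icc cl cu, ∀ q ∈ Set.Icc ql qu, 0 ≤ U (c, q) (c, q)))
    ↔
    -- ... iff (1) envelope formula, (2) ρ nonneg and non-decreasing in q,
    -- (3) X non-increasing in c.
    ((∀ c ∈ Set.Icc cl cu, ∀ q ∈ Set.Icc ql qu,
        ρ c q = ρ cu q + ∫ t in c..cu, X t q) ∧
     ((∀ c ∈ Set.Icc cl cu, ∀ q ∈ Set.Icc ql qu, 0 ≤ ρ c q) ∧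
      (∀ c ∈ Set.Icc cl cu, ∀ q₁ ∈ Set.Icc ql qu, ∀ q₂ ∈ Set.Icc ql qu,
        q₁ ≤ q₂ → ρ c q₁ ≤ ρ c q₂)) ∧
     (∀ q ∈ Set.Icc ql qu, ∀ c₁ ∈ Set.Icc cl cu, ∀ c₂ ∈ Set.Icc cl cu,
        c₁ ≤ c₂ → X c₂ q ≤ X c₁ q)) := by
  simp only [hU, sub_self, zero_mul, sub_zero]
  constructor
  · rintro ⟨hBIC, hIR⟩
    have hsub : ∀ q ∈ Icc ql qu, ∀ c ∈ Icc cl cu, ∀ chat ∈ Icc cl cu,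
        ρ chat q - (c - chat) * X chat q ≤ ρ c q :=
      fun q hq c hc chat hchat => hBIC c hc q hq chat hchat q ⟨hq.1, le_rfl⟩
    refine ⟨fun c hc q hq => ?_, ⟨hIR, fun c hc q₁ hq₁ q₂ hq₂ h => ?_⟩, fun q hq => ?_⟩
    · have hsubset : Icc c cu ⊆ Icc cl cu := Icc_subset_Icc_left hc.1
      exact eq_add_integral_of_subgradient (r := fun c => ρ c q) (x := fun c => X c q) hc.2
        fun t ht s hs => hsub q hq t (hsubset ht) s (hsubset hs)
    · simpa using hBIC c hc q₂ hq₂ c hc q₁ ⟨hq₁.1, h⟩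
    · exact antitoneOn_of_subgradient (r := fun c => ρ c q) (x := fun c => X c q) (hsub q hq)
  · rintro ⟨henv, ⟨hnonneg, hmono⟩, hanti⟩
    refine ⟨fun c hc q hq chat hchat qhat hqhat => ?_, hnonneg⟩
    have hqhat' : qhat ∈ Icc ql qu := ⟨hqhat.1, hqhat.2.trans hq.2⟩
    exact (subgradient_of_eq_add_integral (r := fun c => ρ c qhat) (x := fun c => X c qhat)
      (hanti qhat hqhat') (fun s hs => henv s hs qhat hqhat') hchat hc).trans
      (hmono c hc qhat hqhat' q hq hqhat.2)
end

section
/- Let (X, T) be a reduced-form mechanism for a single-minded capacitated seller. Suppose that: (1) for every (c,q) ∈ [c̲,c̄]×[q̲,q̄], ρ(c,q) = ρ(c̄,q) + ∫_c^{c̄} X(t,q) dt; (2) ρ(c,q) ≥ 0 for all (c,q) and q ↦ ρ(c,q) is non-decreasing on [q̲,q̄] for every fixed c; and (3) c ↦ X(c,q) is non-increasing on [c̲,c̄] for every fixed q. Then the mechanism is Bayesian incentive compatible and interim individually rational: for every true type (c,q) and every report (ĉ,q̂) with ĉ ∈ [c̲,c̄] and q̂ ∈ [q̲,q], one has U((ĉ,q̂),(c,q))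 ≤ U((c,q),(c,q)) and U((c,q),(c,q)) ≥ 0. -/
/-- The integral of an antitone function is at most its value at the starting point times the
signed length of the interval, for either orientation of the interval. -/
theorem AntitoneOn.intervalIntegral_le_sub_mul {f : ℝ → ℝ} {a b : ℝ}
    (hf : AntitoneOn f (Set.uIcc a b)) : ∫ t in a..b, f t ≤ (b - a) * f a := by
  have hint : IntervalIntegrable f MeasureTheory.volume a b := hf.intervalIntegrable
  rcases le_total a b with hab | hab
  · calc ∫ t in a..b, f t ≤ ∫ _ in a..b, f a :=
          intervalIntegral.integral_mono_on hab hint intervalIntegrable_const fun t ht =>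
            hf Set.left_mem_uIcc (Set.Icc_subset_uIcc ht) ht.1
      _ = (b - a) * f a := by simp
  · have key : ∫ _ in b..a, f a ≤ ∫ t in b..a, f t :=
      intervalIntegral.integral_mono_on hab intervalIntegrable_const hint.symm fun t ht =>
        hf (Set.Icc_subset_uIcc' ht) Set.left_mem_uIcc ht.2
    rw [intervalIntegral.integral_const, smul_eq_mul] at key
    rw [intervalIntegral.integral_symm]
    linarith

/-- Sufficiency: if the offered surplus `ρ` of the reduced-form mechanism
`(X, T)` satisfies the envelope formula, is non-negative and non-decreasing
in the capacity, and the allocation `X` is non-increasing in the cost, then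
the mechanism is Bayesian incentive compatible and interim individually
rational. -/
theorem bic_ir_of_envelope_and_monotonicity
    (cl cu ql qu : ℝ) (hc : cl < cu) (hq : ql ≤ qu)
    (X T : ℝ → ℝ → ℝ)
    (ρ : ℝ → ℝ → ℝ)
    (hρ : ∀ c q, ρ c q = T c q - c * X c q)
    (U : ℝ × ℝ → ℝ × ℝ → ℝ)
    (hU : ∀ chat qhat c q, U (chat, qhat) (c, q) = ρ chat qhat - (c - chat) * X chat qhat)
    -- (1) envelope formula
    (henv : ∀ c ∈ Set.Icc cl cu, ∀ q ∈ Set.Icc ql qu,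
        ρ c q = ρ cu q + ∫ t in c..cu, X t q)
    -- (2) ρ non-negative and non-decreasing in q for each fixed c
    (hnonneg : ∀ c ∈ Set.Icc cl cu, ∀ q ∈ Set.Icc ql qu, 0 ≤ ρ c q)
    (hmonoq : ∀ c ∈ Set.Icc cl cu, ∀ q₁ ∈ Set.Icc ql qu, ∀ q₂ ∈ Set.Icc ql qu,
        q₁ ≤ q₂ → ρ c q₁ ≤ ρ c q₂)
    -- (3) X non-increasing in c for each fixed q
    (hmonoc : ∀ q ∈ Set.Icc ql qu, ∀ c₁ ∈ Set.Icc cl cu, ∀ c₂ ∈ Set.Icc cl cu,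
        c₁ ≤ c₂ → X c₂ q ≤ X c₁ q) :
    ∀ c ∈ Set.Icc cl cu, ∀ q ∈ Set.Icc ql qu,
      (∀ chat ∈ Set.Icc cl cu, ∀ qhat ∈ Set.Icc ql q,
          U (chat, qhat) (c, q) ≤ U (c, q) (c, q)) ∧
      0 ≤ U (c, q) (c, q) := by
  intro c hcm q hqm
  have htruth : U (c, q) (c, q) = ρ c q := by simp [hU]
  rw [htruth]
  refine ⟨fun chat hchat qhat hqhat => ?_, hnonneg c hcm q hqm⟩
  have hqhat' : qhat ∈ Set.Icc ql qu := ⟨hqhat.1, hqhat.2.trans hqm.2⟩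
  have hanti : AntitoneOn (fun t => X t qhat) (Set.Icc cl cu) :=
    fun a ha b hb hab => hmonoc qhat hqhat' a ha b hb hab
  have hsub {a b : ℝ} (ha : a ∈ Set.Icc cl cu) (hb : b ∈ Set.Icc cl cu) :
      AntitoneOn (fun t => X t qhat) (Set.uIcc a b) :=
    hanti.mono (Set.uIcc_subset_Icc ha hb)
  have hcu : cu ∈ Set.Icc cl cu := Set.right_mem_Icc.2 hc.le
  have hadd := intervalIntegral.integral_add_adjacent_intervals
    (hsub hchat hcm).intervalIntegrable (hsub hcm hcu).intervalIntegrable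
      (μ := MeasureTheory.volume)
  have hle := (hsub hchat hcm).intervalIntegral_le_sub_mul
  have hq_le := hmonoq c hcm qhat hqhat' q hqm hqhat.2
  rw [hU]
  linarith [henv c hcm qhat hqhat', henv chat hchat qhat hqhat']
end

section
/- Let x : [c̲,c̄]×[q̲,q̄] → ℝ be an allocation rule such that for every fixed q̂, the map ĉ ↦ x(ĉ,q̂) is non-increasing, and for every fixed ĉ, the map q̂ ↦ x(ĉ,q̂) is non-decreasing. Define the payment t(ĉ,q̂) = ĉ·x(ĉ,q̂) + ∫_{ĉ}^{c̄} x(s,q̂) ds. Then truthful reporting is a dominant strategy among feasible reports: for every true type (c,q) ∈ [c̲,c̄]×[q̲,q̄] and every report (ĉ,q̂) with ĉ ∈ [c̲,c̄] and q̂ ∈ [q̲,q], one has t(c,q) − c·x(c,q) ≥ t(ĉ,q̂) − c·x(ĉ,q̂). -/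
/-- The oriented integral of an antitone function from `a` to `b` is at least the oriented length
times the value at the upper limit, in either order of the endpoints. -/
theorem AntitoneOn.sub_mul_le_intervalIntegral {f : ℝ → ℝ} {a b : ℝ}
    (hf : AntitoneOn f (Set.uIcc a b)) : (b - a) * f b ≤ ∫ s in a..b, f s := by
  have hint := hf.intervalIntegrable (μ := MeasureTheory.volume)
  have hconst : ∫ _ in a..b, f b = (b - a) * f b := by simp
  rw [← hconst]
  rcases le_total a b with hab | hba
  · refine intervalIntegral.integral_mono_on hab (by simp) hint fun s hs => ?_
    rw [← Set.uIcc_of_le hab] at hs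
    exact hf hs Set.right_mem_uIcc (Set.uIcc_of_le hab ▸ hs).2
  · rw [intervalIntegral.integral_symm b a, intervalIntegral.integral_symm b a, neg_le_neg_iff]
    refine intervalIntegral.integral_mono_on hba hint.symm (by simp) fun s hs => ?_
    rw [← Set.uIcc_of_ge hba] at hs
    exact hf Set.right_mem_uIcc hs (Set.uIcc_of_ge hba ▸ hs).1


/-- Dominant-strategy incentive compatibility of the optimal auction under
the monotonicity conditions: if the allocation `x(ĉ,q̂)` is non-increasing
in the reported cost `ĉ` and non-decreasing in the reported capacity `q̂`,
and the payment is `t(ĉ,q̂) = ĉ·x(ĉ,q̂) + ∫_{ĉ}^{c̄} x(s,q̂) ds`, then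
truthful reporting is a dominant strategy among feasible reports
(`q̂ ≤ q`, since a seller never over-reports his capacity). -/
theorem truthful_reporting_dominant
    (cl cu ql qu : ℝ) (hc : cl < cu) (hq : ql ≤ qu)
    (x : ℝ → ℝ → ℝ)
    (hx_anti : ∀ qhat ∈ Set.Icc ql qu, AntitoneOn (fun chat => x chat qhat) (Set.Icc cl cu))
    (hx_mono : ∀ chat ∈ Set.Icc cl cu, MonotoneOn (fun qhat => x chat qhat) (Set.Icc ql qu))
    (t : ℝ → ℝ → ℝ)
    (ht : ∀ chat qhat, t chat qhat = chat * x chat qhat + ∫ s in chat..cu, x s qhat) :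
    ∀ c ∈ Set.Icc cl cu, ∀ q ∈ Set.Icc ql qu,
      ∀ chat ∈ Set.Icc cl cu, ∀ qhat ∈ Set.Icc ql q,
        t chat qhat - c * x chat qhat ≤ t c q - c * x c q := by
  intro c hc_mem q hq_mem chat hchat qhat hqhat
  have hqhat_mem : qhat ∈ Set.Icc ql qu := ⟨hqhat.1, hqhat.2.trans hq_mem.2⟩
  have hcu : cu ∈ Set.Icc cl cu := ⟨hc.le, le_rfl⟩
  have hint : ∀ p ∈ Set.Icc ql qu, ∀ a ∈ Set.Icc cl cu, ∀ b ∈ Set.Icc cl cu,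
      IntervalIntegrable (fun s => x s p) MeasureTheory.volume a b := fun p hp a ha b hb =>
    ((hx_anti p hp).mono (Set.uIcc_subset_Icc ha hb)).intervalIntegrable
  have hcapacity : ∫ s in c..cu, x s qhat ≤ ∫ s in c..cu, x s q :=
    intervalIntegral.integral_mono_on hc_mem.2 (hint qhat hqhat_mem c hc_mem cu hcu)
      (hint q hq_mem c hc_mem cu hcu) fun s hs =>
        hx_mono s ⟨hc_mem.1.trans hs.1, hs.2⟩ hqhat_mem hq_mem hqhat.2
  have hcost : (chat - c) * x chat qhat ≤ ∫ s in c..chat, x s qhat :=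
    ((hx_anti qhat hqhat_mem).mono
      (Set.uIcc_subset_Icc hc_mem hchat)).sub_mul_le_intervalIntegral
  have hsplit := intervalIntegral.integral_add_adjacent_intervals
    (hint qhat hqhat_mem c hc_mem chat hchat) (hint qhat hqhat_mem chat hchat cu hcu)
  rw [ht, ht]
  linarith
end
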